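/- Let a_1, a_2, a_3 > 0 be real numbers and b ∈ ℝ such that for every cyclic permutation (i,j,k) of (1,2,3) one has 2·a_i²·(a_j²/a_k² + a_k²/a_j²) − 2·a_j²·a_k²/a_i² = b. Then a_1 = a_2 = a_3. -/

import Mathlib

/-- If positive reals `a₁, a₂, a₃` satisfy the torsion-critical condition
`2aᵢ²(aⱼ²/aₖ² + aₖ²/aⱼ²) − 2aⱼ²aₖ²/aᵢ² = b` for all cyclic permutations `(i,j,k)` of
`(1,2,3)`, then `a₁ = a₂ = a₃`. -/
theorem torsion_critical_sl2_eq'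
    (a₁ a₂ a₃ : ℝ) (h₁ : 0 < a₁) (h₂ : 0 < a₂) (h₃ : 0 < a₃) (b : ℝ)
    (e₁ : 2 * a₁ ^ 2 * (a₂ ^ 2 / a₃ ^ 2 + a₃ ^ 2 / a₂ ^ 2) - 2 * a₂ ^ 2 * a₃ ^ 2 / a₁ ^ 2 = b)
    (e₂ : 2 * a₂ ^ 2 * (a₃ ^ 2 / a₁ ^ 2 + a₁ ^ 2 / a₃ ^ 2) - 2 * a₃ ^ 2 * a₁ ^ 2 / a₂ ^ 2 = b)
    (e₃ : 2 * a₃ ^ 2 * (a₁ ^ 2 / a₂ ^ 2 + a₂ ^ 2 / a₁ ^ 2) - 2 * a₁ ^ 2 * a₂ ^ 2 / a₃ ^ 2 = b) :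
    a₁ = a₂ ∧ a₂ = a₃ := by
  have key : ∀ x y z : ℝ, 0 < x → 0 < y → 0 < z →
      y ^ 2 * z ^ 2 / x ^ 2 = x ^ 2 * z ^ 2 / y ^ 2 → x = y := by
    intro x y z hx hy hz h
    rw [div_eq_div_iff (by positivity) (by positivity)] at h
    have h' : (x ^ 4 - y ^ 4) * z ^ 2 = 0 := by linear_combination -h
    have h4 : x ^ 4 - y ^ 4 = 0 := by
      rcases mul_eq_zero.mp h' with h | h
      · exact h
      · exact absurd h (by positivity)
    exact (pow_left_inj₀ hx.le hy.le (by norm_num : (4 : ℕ) ≠ 0)).mp (by linarith)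
  constructor
  · apply key a₁ a₂ a₃ h₁ h₂ h₃
    linear_combination (e₂ - e₁) / 4
  · apply key a₂ a₃ a₁ h₂ h₃ h₁
    linear_combination (e₃ - e₂) / 4
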